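/- arXiv:1201.5317 — 6 statements merged into one kernel-verified Lean document; each statement's English description precedes it below -/
import Mathlib

section
/- Let (Γ,G) be a locally-Z2^[3] pair. Then for every vertex v of Γ: (i) there is exactly one neighbour v' of v that is fixed by every element of the stabiliser G_v; (ii) G_v = G_{v'}; (iii) (v')' = v; and (iv) for every g ∈ G, (g(v))' = g(v'). -/
variable {V : Type*}

/-- The set of orbits of the vertex-stabiliser `G_v` on the neighbourhood `Γ(v)`. -/
def nbhdOrbits (Γ : SimpleGraph V) (G : Subgroup (Γ ≃g Γ)) (v : V) : Set (Set V) :=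
  {O | ∃ u ∈ Γ.neighborSet v, O = {w | ∃ g ∈ G, g v = v ∧ g u = w}}

/-- `IsSpecialNbr Γ G v u` says that `u` is a neighbour of `v` fixed by every element of the
stabiliser `G_v`. -/
def IsSpecialNbr (Γ : SimpleGraph V) (G : Subgroup (Γ ≃g Γ)) (v u : V) : Prop :=
  Γ.Adj v u ∧ ∀ g ∈ G, g v = v → g u = u

/-- The orbit of `u` under the stabiliser of `v` in `G`. -/
def stabOrbit (Γ : SimpleGraph V) (G : Subgroup (Γ ≃g Γ)) (v u : V) : Set V :=
  {w | ∃ g ∈ G, g v = v ∧ g u = w}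

lemma mem_stabOrbit_self (Γ : SimpleGraph V) (G : Subgroup (Γ ≃g Γ)) (v u : V) :
    u ∈ stabOrbit Γ G v u :=
  ⟨1, G.one_mem, rfl, rfl⟩

lemma inv_apply_eq_of_apply_eq {Γ : SimpleGraph V} {g : Γ ≃g Γ} {u w : V} (h : g u = w) :
    g⁻¹ w = u := by
  rw [← h]
  exact g.symm_apply_apply u

lemma stabOrbit_apply {Γ : SimpleGraph V} {G : Subgroup (Γ ≃g Γ)} {v : V} {g : Γ ≃g Γ}
    (hg : g ∈ G) (hgv : g v = v) (u : V) : stabOrbit Γ G v (g u) = stabOrbit Γ G v u := by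
  ext w
  constructor
  · rintro ⟨h, hh, hv, rfl⟩
    exact ⟨h * g, G.mul_mem hh hg, by rw [RelIso.mul_apply, hgv, hv], rfl⟩
  · rintro ⟨h, hh, hv, rfl⟩
    refine ⟨h * g⁻¹, G.mul_mem hh (G.inv_mem hg), ?_, ?_⟩
    · rw [RelIso.mul_apply, inv_apply_eq_of_apply_eq hgv, hv]
    · rw [RelIso.mul_apply, inv_apply_eq_of_apply_eq rfl]

lemma existsUnique_isSpecialNbr_of_stabOrbit {Γ : SimpleGraph V} {G : Subgroup (Γ ≃g Γ)}
    {v a b c : V} (hN : Γ.neighborSet v = {a, b, c}) (hab : a ≠ b)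
    (h : stabOrbit Γ G v a = stabOrbit Γ G v b) (hc : stabOrbit Γ G v a ≠ stabOrbit Γ G v c) :
    ∃! u : V, IsSpecialNbr Γ G v u := by
  have hmem : ∀ x, Γ.Adj v x ↔ x = a ∨ x = b ∨ x = c := fun x => by
    rw [← SimpleGraph.mem_neighborSet, hN]
    simp
  refine ⟨c, ⟨(hmem c).2 (by simp), fun g hg hgv => ?_⟩, ?_⟩
  · have hadj : Γ.Adj v (g c) := by
      have := g.map_adj_iff.2 ((hmem c).2 (by simp))
      rwa [hgv] at this
    have horbit := stabOrbit_apply hg hgv c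
    rcases (hmem _).1 hadj with h' | h' | h'
    · rw [h'] at horbit
      exact (hc horbit).elim
    · rw [h', ← h] at horbit
      exact (hc horbit).elim
    · exact h'
  · rintro u ⟨hu, hfix⟩
    rcases (hmem _).1 hu with rfl | rfl | rfl
    · obtain ⟨g, hg, hgv, hgu⟩ : b ∈ stabOrbit Γ G v u := h ▸ mem_stabOrbit_self Γ G v b
      exact (hab ((hfix g hg hgv).symm.trans hgu)).elim
    · obtain ⟨g, hg, hgv, hgu⟩ : a ∈ stabOrbit Γ G v u := h ▸ mem_stabOrbit_self Γ G v a
      exact (hab (hgu.symm.trans (hfix g hg hgv))).elim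
    · rfl

lemma existsUnique_isSpecialNbr {Γ : SimpleGraph V} {G : Subgroup (Γ ≃g Γ)} {v : V}
    (hcubic : (Γ.neighborSet v).ncard = 3) (horb : (nbhdOrbits Γ G v).ncard = 2) :
    ∃! u : V, IsSpecialNbr Γ G v u := by
  obtain ⟨a, b, c, hab, hac, hbc, hN⟩ := Set.ncard_eq_three.1 hcubic
  have hO : nbhdOrbits Γ G v =
      {stabOrbit Γ G v a, stabOrbit Γ G v b, stabOrbit Γ G v c} := by
    ext O
    simp [nbhdOrbits, stabOrbit, hN, -SimpleGraph.mem_neighborSet]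
  rw [hO] at horb
  by_cases h₁ : stabOrbit Γ G v a = stabOrbit Γ G v b
  · refine existsUnique_isSpecialNbr_of_stabOrbit hN hab h₁ fun h => ?_
    simp [← h₁, ← h] at horb
  by_cases h₂ : stabOrbit Γ G v a = stabOrbit Γ G v c
  · exact existsUnique_isSpecialNbr_of_stabOrbit (by rw [hN, Set.pair_comm b c]) hac h₂ h₁
  by_cases h₃ : stabOrbit Γ G v b = stabOrbit Γ G v c
  · refine existsUnique_isSpecialNbr_of_stabOrbit (c := a) ?_ hbc h₃ (Ne.symm h₁)
    rw [hN, Set.insert_comm a b, Set.pair_comm a c]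
  · have := Set.ncard_eq_three.2 ⟨_, _, _, h₁, h₂, h₃, rfl⟩
    omega

lemma IsSpecialNbr.map {Γ : SimpleGraph V} {G : Subgroup (Γ ≃g Γ)} {v u : V}
    (h : IsSpecialNbr Γ G v u) {g : Γ ≃g Γ} (hg : g ∈ G) :
    IsSpecialNbr Γ G (g v) (g u) := by
  refine ⟨g.map_adj_iff.2 h.1, fun k hk hkv => ?_⟩
  have hfix := h.2 (g⁻¹ * (k * g)) (G.mul_mem (G.inv_mem hg) (G.mul_mem hk hg))
    (inv_apply_eq_of_apply_eq hkv.symm)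
  rw [RelIso.mul_apply, RelIso.mul_apply] at hfix
  simpa using congrArg g hfix

lemma IsSpecialNbr.apply_eq_iff [Finite V] {Γ : SimpleGraph V} {G : Subgroup (Γ ≃g Γ)}
    (htrans : ∀ u w : V, ∃ g ∈ G, g u = w) (huniq : ∀ v : V, ∃! u : V, IsSpecialNbr Γ G v u)
    {v u : V} (h : IsSpecialNbr Γ G v u) {g : Γ ≃g Γ} (hg : g ∈ G) :
    g v = v ↔ g u = u := by
  refine ⟨h.2 g hg, fun hgu => ?_⟩
  choose f hf hf' using huniq
  have hsurj : Function.Surjective f := fun w => by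
    obtain ⟨k, hk, rfl⟩ := htrans u w
    exact ⟨k v, (hf' _ _ (h.map hk)).symm⟩
  refine Finite.injective_iff_surjective.2 hsurj ?_
  rw [← hf' _ _ (h.map hg), ← hf' _ _ h, hgu]

/-- Let `(Γ,G)` be a locally-`Z2^[3]` pair (a finite connected cubic graph `Γ`
with a vertex-transitive group `G` of automorphisms whose vertex-stabilisers have exactly two
orbits on each neighbourhood). Then for every vertex `v`:
(i) there is exactly one neighbour `v'` of `v` fixed by every element of `G_v`;
(ii) `G_v = G_{v'}`; (iii) `(v')' = v`; (iv) for every `g ∈ G`, `(g v)' = g (v')`. -/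
theorem stmt_5 [Fintype V] (Γ : SimpleGraph V) (hconn : Γ.Connected)
    (hcubic : ∀ v : V, (Γ.neighborSet v).ncard = 3)
    (G : Subgroup (Γ ≃g Γ))
    (htrans : ∀ u w : V, ∃ g ∈ G, g u = w)
    (horb : ∀ v : V, (nbhdOrbits Γ G v).ncard = 2) :
    (∀ v : V, ∃! u : V, IsSpecialNbr Γ G v u) ∧
    (∀ v u : V, IsSpecialNbr Γ G v u → ∀ g ∈ G, (g v = v ↔ g u = u)) ∧
    (∀ v u : V, IsSpecialNbr Γ G v u → IsSpecialNbr Γ G u v) ∧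
    (∀ v u : V, IsSpecialNbr Γ G v u → ∀ g ∈ G, IsSpecialNbr Γ G (g v) (g u)) := by
  have huniq := fun v => existsUnique_isSpecialNbr (hcubic v) (horb v)
  exact ⟨huniq, fun _ _ h _ hg => h.apply_eq_iff htrans huniq hg,
    fun _ _ h => ⟨h.1.symm, fun _ hg hgu => (h.apply_eq_iff htrans huniq hg).2 hgu⟩,
    fun _ _ h _ hg => h.map hg⟩
end

section
/- Let (Γ,G) be a locally-Z2^[3] pair, for each vertex v let v' be the unique neighbour of v fixed by G_v, let T be the set of edges {v,v'} for v ∈ V(Γ), and let R be the set of edges of Γ not in T. Then: (i) T is a perfect matching of Γ (every vertex lies in exactly one edge of T); (ii) G acts transitively on T; (iii) every vertex is incident with exactly two edges of R; and (iv) G has exactly two orbits on the edge set of Γ (namely T and R) and exactly two orbits on the arc set of Γ. -/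
variable {V : Type*}

/-- The set of orbits of `G` on the arcs (ordered pairs of adjacent vertices) of `Γ`. -/
def arcOrbits (Γ : SimpleGraph V) (G : Subgroup (Γ ≃g Γ)) : Set (Set (V × V)) :=
  {O | ∃ a : V × V, Γ.Adj a.1 a.2 ∧ O = {b | ∃ g ∈ G, (g a.1, g a.2) = b}}

/-- The set of orbits of `G` on the edges of `Γ`. -/
def edgeOrbits (Γ : SimpleGraph V) (G : Subgroup (Γ ≃g Γ)) : Set (Set (Sym2 V)) :=
  {O | ∃ e ∈ Γ.edgeSet, O = {e' | ∃ g ∈ G, Sym2.map (⇑g) e = e'}}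

section FixedNeighbour

variable {Γ : SimpleGraph V} {G : Subgroup (Γ ≃g Γ)} {f : V → V}

/-- The map sending a vertex to the unique neighbour fixed by its stabiliser is equivariant. -/
theorem fixedNeighbour_equivariant
    (hf1 : ∀ v, Γ.Adj v (f v))
    (hf2 : ∀ v, ∀ g ∈ G, g v = v → g (f v) = f v)
    (hf3 : ∀ v u, Γ.Adj v u → (∀ g ∈ G, g v = v → g u = u) → u = f v)
    {g : Γ ≃g Γ} (hg : g ∈ G) (v : V) : g (f v) = f (g v) := by
  refine hf3 (g v) (g (f v)) (g.map_adj_iff.2 (hf1 v)) fun h hh hv => ?_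
  have key := hf2 v (g⁻¹ * (h * g)) (G.mul_mem (G.inv_mem hg) (G.mul_mem hh hg))
    (by simp [RelIso.mul_apply, hv])
  have := congrArg g key
  simpa [RelIso.mul_apply] using this

/-- On a finite vertex-transitive graph, the fixed-neighbour map is an involution. -/
theorem fixedNeighbour_involutive [Finite V]
    (htrans : ∀ u w : V, ∃ g ∈ G, g u = w)
    (hf1 : ∀ v, Γ.Adj v (f v))
    (hf2 : ∀ v, ∀ g ∈ G, g v = v → g (f v) = f v)
    (hf3 : ∀ v u, Γ.Adj v u → (∀ g ∈ G, g v = v → g u = u) → u = f v) :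
    Function.Involutive f := by
  have hequi {g : Γ ≃g Γ} (hg : g ∈ G) (v : V) : g (f v) = f (g v) :=
    fixedNeighbour_equivariant hf1 hf2 hf3 hg v
  have hsurj : Function.Surjective f := fun w => by
    obtain ⟨g, hg, hw⟩ := htrans (f w) w
    exact ⟨g w, by rw [← hequi hg, hw]⟩
  have hinj : Function.Injective f := Finite.injective_iff_surjective.2 hsurj
  intro v
  refine (hf3 (f v) v (hf1 v).symm fun g hg hv => hinj ?_).symm
  rw [← hequi hg, hv]

/-- If a vertex stabiliser has two orbits on the neighbourhood, it is transitive on the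
neighbours other than the one it fixes. -/
theorem exists_stabilizer_map_of_ne_fixedNeighbour {v : V}
    (horb : (nbhdOrbits Γ G v).ncard = 2)
    (hf1 : Γ.Adj v (f v)) (hf2 : ∀ g ∈ G, g v = v → g (f v) = f v)
    {a b : V} (ha : Γ.Adj v a) (hb : Γ.Adj v b) (ha' : a ≠ f v) (hb' : b ≠ f v) :
    ∃ g ∈ G, g v = v ∧ g a = b := by
  let orb (u : V) : Set V := {w | ∃ g ∈ G, g v = v ∧ g u = w}
  have hself (u : V) : u ∈ orb u := ⟨1, G.one_mem, rfl, rfl⟩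
  have hne {u : V} (hu : u ≠ f v) : orb (f v) ≠ orb u := fun h => by
    obtain ⟨g, hg, hv, hgu⟩ : u ∈ orb (f v) := h ▸ hself u
    exact hu (hgu ▸ hf2 g hg hv)
  have hmem {u : V} (hu : Γ.Adj v u) : orb u ∈ nbhdOrbits Γ G v := ⟨u, hu, rfl⟩
  obtain ⟨x, y, -, hxy⟩ := Set.ncard_eq_two.1 horb
  have hf := hmem hf1
  have hA := hmem ha
  have hB := hmem hb
  have hAne := hne ha'
  have hBne := hne hb'
  rw [hxy, Set.mem_insert_iff, Set.mem_singleton_iff] at hf hA hB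
  have hab : orb a = orb b := by grind
  exact (hab ▸ hself b : b ∈ orb a)

/-- A vertex-transitive group with two orbits on each neighbourhood is transitive on the arcs that
do not join a vertex to its fixed neighbour. -/
theorem exists_map_arc_of_ne_fixedNeighbour
    (htrans : ∀ u w : V, ∃ g ∈ G, g u = w)
    (horb : ∀ v, (nbhdOrbits Γ G v).ncard = 2)
    (hf1 : ∀ v, Γ.Adj v (f v))
    (hf2 : ∀ v, ∀ g ∈ G, g v = v → g (f v) = f v)
    (hequi : ∀ g ∈ G, ∀ v, g (f v) = f (g v))
    {v a w b : V} (ha : Γ.Adj v a) (hb : Γ.Adj w b) (ha' : a ≠ f v) (hb' : b ≠ f w) :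
    ∃ g ∈ G, g v = w ∧ g a = b := by
  obtain ⟨g, hg, rfl⟩ := htrans v w
  obtain ⟨h, hh, hv, hab⟩ := exists_stabilizer_map_of_ne_fixedNeighbour (horb (g v)) (hf1 _)
    (hf2 _) (g.map_adj_iff.2 ha) hb (fun h => ha' (g.injective (h.trans (hequi g hg v).symm))) hb'
  exact ⟨h * g, G.mul_mem hh hg, hv, hab⟩

end FixedNeighbour

/-- Let `(Γ,G)` be a locally-`Z2^[3]` pair, for each vertex `v` let `f v = v'` be
the unique neighbour of `v` fixed by `G_v`, let `T` be the set of edges `{v,v'}` and `R` the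
set of edges of `Γ` not in `T`. Then: (i) `T` is a perfect matching of `Γ`; (ii) `G` acts
transitively on `T`; (iii) every vertex is incident with exactly two edges of `R`; and
(iv) `G` has exactly two orbits on the edge set of `Γ`, namely `T` and `R`, and exactly two
orbits on the arc set of `Γ`. -/
theorem stmt_6 [Fintype V] (Γ : SimpleGraph V) (hconn : Γ.Connected)
    (hcubic : ∀ v : V, (Γ.neighborSet v).ncard = 3)
    (G : Subgroup (Γ ≃g Γ))
    (htrans : ∀ u w : V, ∃ g ∈ G, g u = w)
    (horb : ∀ v : V, (nbhdOrbits Γ G v).ncard = 2)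
    (f : V → V)
    (hf1 : ∀ v : V, Γ.Adj v (f v))
    (hf2 : ∀ v : V, ∀ g ∈ G, g v = v → g (f v) = f v)
    (hf3 : ∀ v u : V, Γ.Adj v u → (∀ g ∈ G, g v = v → g u = u) → u = f v)
    (T R : Set (Sym2 V))
    (hT : T = {e : Sym2 V | ∃ v : V, e = s(v, f v)})
    (hR : R = Γ.edgeSet \ T) :
    (∀ v : V, ∃! e : Sym2 V, e ∈ T ∧ v ∈ e) ∧
    (∀ e₁ ∈ T, ∀ e₂ ∈ T, ∃ g ∈ G, Sym2.map (⇑g) e₁ = e₂) ∧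
    (∀ v : V, {e : Sym2 V | e ∈ R ∧ v ∈ e}.ncard = 2) ∧
    (edgeOrbits Γ G = {T, R} ∧ (arcOrbits Γ G).ncard = 2) := by
  have hequi : ∀ g ∈ G, ∀ v, g (f v) = f (g v) := fun g hg v =>
    fixedNeighbour_equivariant hf1 hf2 hf3 hg v
  have hinv : Function.Involutive f := fixedNeighbour_involutive htrans hf1 hf2 hf3
  have harcT (v w : V) : ∃ g ∈ G, g v = w ∧ g (f v) = f w := by
    obtain ⟨g, hg, rfl⟩ := htrans v w
    exact ⟨g, hg, rfl, hequi g hg v⟩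
  have harcR {v a w b : V} (ha : Γ.Adj v a) (hb : Γ.Adj w b) (ha' : a ≠ f v) (hb' : b ≠ f w) :
      ∃ g ∈ G, g v = w ∧ g a = b :=
    exists_map_arc_of_ne_fixedNeighbour htrans horb hf1 hf2 hequi ha hb ha' hb'
  have hmap_ne {g : Γ ≃g Γ} (hg : g ∈ G) {v a : V} (ha : a ≠ f v) : g a ≠ f (g v) := fun h =>
    ha (g.injective (h.trans (hequi g hg v).symm))
  have hmemT (v a : V) : s(v, a) ∈ T ↔ a = f v := by
    subst hT
    constructor
    · rintro ⟨w, hw⟩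
      rcases Sym2.eq_iff.1 hw with ⟨rfl, rfl⟩ | ⟨rfl, rfl⟩
      · rfl
      · exact (hinv _).symm
    · rintro rfl
      exact ⟨v, rfl⟩
  have hmemR (v a : V) : s(v, a) ∈ R ↔ Γ.Adj v a ∧ a ≠ f v := by
    rw [hR, Set.mem_sdiff, SimpleGraph.mem_edgeSet, hmemT]
  have hothers (v : V) : (Γ.neighborSet v \ {f v}).ncard = 2 := by
    rw [Set.ncard_sdiff_singleton_of_mem ((Γ.mem_neighborSet v (f v)).2 (hf1 v)), hcubic]
  have hexists (v : V) : ∃ a, Γ.Adj v a ∧ a ≠ f v :=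
    Set.nonempty_of_ncard_ne_zero (by rw [hothers v]; decide : (Γ.neighborSet v \ {f v}).ncard ≠ 0)
  have horbT (v : V) : {e' | ∃ g ∈ G, Sym2.map (⇑g) s(v, f v) = e'} = T := by
    ext e
    induction e with | _ w b
    rw [hmemT]
    constructor
    · rintro ⟨g, hg, he⟩
      rw [Sym2.map_mk, hequi g hg] at he
      exact (hmemT w b).1 (he ▸ (hmemT _ _).2 rfl)
    · rintro rfl
      obtain ⟨g, hg, hv, hfv⟩ := harcT v w
      exact ⟨g, hg, by rw [Sym2.map_mk, hv, hfv]⟩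
  have horbR {v a : V} (ha : Γ.Adj v a) (ha' : a ≠ f v) :
      {e' | ∃ g ∈ G, Sym2.map (⇑g) s(v, a) = e'} = R := by
    ext e
    induction e with | _ w b
    constructor
    · rintro ⟨g, hg, he⟩
      rw [← he, Sym2.map_mk, hmemR]
      exact ⟨g.map_adj_iff.2 ha, hmap_ne hg ha'⟩
    · rw [hmemR]
      rintro ⟨hb, hb'⟩
      obtain ⟨g, hg, hv, hab⟩ := harcR ha hb ha' hb'
      exact ⟨g, hg, by rw [Sym2.map_mk, hv, hab]⟩
  obtain ⟨v₀⟩ := hconn.nonempty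
  obtain ⟨a₀, ha₀, ha₀'⟩ := hexists v₀
  refine ⟨fun v => ⟨s(v, f v), ⟨(hmemT _ _).2 rfl, Sym2.mem_mk_left _ _⟩, ?_⟩, ?_, fun v => ?_, ?_, ?_⟩
  · rintro e ⟨he, hv⟩
    obtain ⟨a, rfl⟩ := hv
    rw [(hmemT v a).1 he]
  · intro e₁ he₁ e₂ he₂
    obtain ⟨v, rfl⟩ : ∃ v, e₁ = s(v, f v) := by rwa [hT] at he₁
    rwa [← horbT v] at he₂
  · have himage : {e : Sym2 V | e ∈ R ∧ v ∈ e} = (fun a => s(v, a)) '' (Γ.neighborSet v \ {f v}) := by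
      ext e
      constructor
      · rintro ⟨he, a, rfl⟩
        exact ⟨a, (hmemR v a).1 he, rfl⟩
      · rintro ⟨a, ha, rfl⟩
        exact ⟨(hmemR v a).2 ha, Sym2.mem_mk_left _ _⟩
    rw [himage, Set.ncard_image_of_injective _ fun a b h => Sym2.congr_right.1 h, hothers]
  · ext O
    constructor
    · rintro ⟨e, he, rfl⟩
      induction e with | _ v a
      by_cases ha : a = f v
      · subst ha
        exact Or.inl (horbT v)
      · exact Or.inr (horbR he ha)
    · rintro (rfl | rfl)
      · exact ⟨s(v₀, f v₀), hf1 v₀, (horbT v₀).symm⟩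
      · exact ⟨s(v₀, a₀), ha₀, (horbR ha₀ ha₀').symm⟩
  · have hA {v a : V} (ha : a = f v) :
        {b | ∃ g ∈ G, (g v, g a) = b} = {p : V × V | p.2 = f p.1} := by
      subst ha
      ext ⟨w, b⟩
      constructor
      · rintro ⟨g, hg, h⟩
        rw [← h]
        exact hequi g hg v
      · rintro (rfl : b = f w)
        obtain ⟨g, hg, hv, hfv⟩ := harcT v w
        exact ⟨g, hg, Prod.ext hv hfv⟩
    have hB {v a : V} (ha : Γ.Adj v a) (ha' : a ≠ f v) :
        {b | ∃ g ∈ G, (g v, g a) = b} = {p : V × V | Γ.Adj p.1 p.2 ∧ p.2 ≠ f p.1} := by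
      ext ⟨w, b⟩
      constructor
      · rintro ⟨g, hg, h⟩
        rw [← h]
        exact ⟨g.map_adj_iff.2 ha, hmap_ne hg ha'⟩
      · rintro ⟨hb, hb'⟩
        obtain ⟨g, hg, hv, hab⟩ := harcR ha hb ha' hb'
        exact ⟨g, hg, Prod.ext hv hab⟩
    refine Set.ncard_eq_two.2 ⟨{p | p.2 = f p.1}, {p | Γ.Adj p.1 p.2 ∧ p.2 ≠ f p.1}, ?_, ?_⟩
    · intro h
      have : (v₀, f v₀) ∈ {p : V × V | Γ.Adj p.1 p.2 ∧ p.2 ≠ f p.1} := h ▸ rfl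
      exact this.2 rfl
    · ext O
      constructor
      · rintro ⟨⟨v, a⟩, ha, rfl⟩
        by_cases ha' : a = f v
        · exact Or.inl (hA ha')
        · exact Or.inr (hB ha ha')
      · rintro (rfl | rfl)
        · exact ⟨(v₀, f v₀), hf1 v₀, (hA rfl).symm⟩
        · exact ⟨(v₀, a₀), ha₀, (hB ha₀ ha₀').symm⟩
end

section
/- Let (Γ,G) be a locally-Z2^[3] pair, and for each vertex v let v' be the unique neighbour of v fixed by G_v. If for some vertex u the edge {u,u'} is contained in a 3-cycle of Γ, then Γ is isomorphic to the complete graph K4 on 4 vertices. -/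
variable {V : Type*}

/-- A choice of neighbours, each the only one fixed by the vertex stabiliser, is equivariant. -/
theorem apply_stabilizer_fixed_neighbor {Γ : SimpleGraph V} {G : Subgroup (Γ ≃g Γ)}
    (f : V → V) (hadj : ∀ v, Γ.Adj v (f v))
    (hfix : ∀ v, ∀ g ∈ G, g v = v → g (f v) = f v)
    (huniq : ∀ v u, Γ.Adj v u → (∀ g ∈ G, g v = v → g u = u) → u = f v)
    (g : Γ ≃g Γ) (hg : g ∈ G) (v : V) : f (g v) = g (f v) := by
  refine (huniq _ _ (g.map_adj_iff.2 (hadj v)) fun h hh hv => ?_).symm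
  have h1 : (g⁻¹ * h * g) v = v := by
    change g.symm (h (g v)) = v
    rw [hv]
    exact g.symm_apply_apply v
  have h2 : g.symm (h (g (f v))) = f v :=
    hfix v _ (G.mul_mem (G.mul_mem (G.inv_mem hg) hh) hg) h1
  rw [← g.apply_symm_apply (h (g (f v))), h2]

/-- A connected graph of maximum degree at most `n` containing a clique on `n + 1` vertices
is complete on `n + 1` vertices. -/
theorem nonempty_iso_top_of_isNClique [Finite V] {Γ : SimpleGraph V} (hconn : Γ.Connected)
    {n : ℕ} (hdeg : ∀ v, (Γ.neighborSet v).ncard ≤ n) {s : Set V} (hs : Γ.IsClique s)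
    (hcard : s.ncard = n + 1) : Nonempty (Γ ≃g (⊤ : SimpleGraph (Fin (n + 1)))) := by
  have hclosed : ∀ v ∈ s, ∀ w, Γ.Adj v w → w ∈ s := by
    intro v hv w hvw
    have hsub : s \ {v} ⊆ Γ.neighborSet v := fun x hx => hs hv hx.1 (Ne.symm hx.2)
    have heq := Set.eq_of_subset_of_ncard_le hsub (by
      rw [Set.ncard_sdiff_singleton_of_mem hv, hcard]
      exact hdeg v)
    have hw : w ∈ s \ {v} := heq ▸ hvw
    exact hw.1
  obtain ⟨v₀, hv₀⟩ : s.Nonempty := Set.nonempty_of_ncard_ne_zero (by omega)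
  have huniv : s = Set.univ := by
    refine Set.eq_univ_of_forall fun w => ?_
    obtain ⟨p⟩ := hconn.preconnected v₀ w
    induction p with
    | nil => exact hv₀
    | cons h _ ih => exact ih (hclosed _ hv₀ _ h)
  rw [huniv, Set.ncard_univ] at hcard
  refine ⟨⟨Finite.equivFinOfCardEq hcard, fun {a b} => ?_⟩⟩
  rw [SimpleGraph.top_adj, (Finite.equivFinOfCardEq hcard).injective.ne_iff]
  exact ⟨fun h => hs (huniv ▸ Set.mem_univ a) (huniv ▸ Set.mem_univ b) h, fun h => h.ne⟩

/-- Let `(Γ,G)` be a locally-`Z2^[3]` pair and for each vertex `v` let `f v = v'`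
be the unique neighbour of `v` fixed by `G_v`. If for some vertex `u` the edge `{u,u'}` is
contained in a 3-cycle of `Γ`, then `Γ` is isomorphic to the complete graph `K₄` on 4
vertices. -/
theorem stmt_8 [Fintype V] (Γ : SimpleGraph V) (hconn : Γ.Connected)
    (hcubic : ∀ v : V, (Γ.neighborSet v).ncard = 3)
    (G : Subgroup (Γ ≃g Γ))
    (htrans : ∀ u w : V, ∃ g ∈ G, g u = w)
    (horb : ∀ v : V, (nbhdOrbits Γ G v).ncard = 2)
    (f : V → V)
    (hf1 : ∀ v : V, Γ.Adj v (f v))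
    (hf2 : ∀ v : V, ∀ g ∈ G, g v = v → g (f v) = f v)
    (hf3 : ∀ v u : V, Γ.Adj v u → (∀ g ∈ G, g v = v → g u = u) → u = f v)
    (htri : ∃ u w : V, Γ.Adj u w ∧ Γ.Adj (f u) w) :
    Nonempty (Γ ≃g (⊤ : SimpleGraph (Fin 4))) := by
  have hequiv := apply_stabilizer_fixed_neighbor f hf1 hf2 hf3
  have hinj : Function.Injective f := by
    rw [Finite.injective_iff_surjective]
    intro w
    obtain ⟨u⟩ := hconn.nonempty
    obtain ⟨g, hg, rfl⟩ := htrans (f u) w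
    exact ⟨g u, hequiv g hg u⟩
  have hinv : ∀ v, f (f v) = v := fun v =>
    (hf3 (f v) v (hf1 v).symm fun g hg h => hinj ((hequiv g hg v).trans h)).symm
  obtain ⟨t, w, htw, hftw⟩ := htri
  have hwt : w ≠ f t := fun h => hftw.ne h.symm
  have hadj_t : ∀ x, Γ.Adj t x → x ≠ f t → Γ.Adj (f t) x := by
    intro x hx hxt
    by_cases hxw : x = w
    · rwa [hxw]
    obtain ⟨g, hg, hgt, hgw⟩ : ∃ g ∈ G, g t = t ∧ g w ≠ w := by
      by_contra! h
      exact hwt (hf3 t w htw h)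
    have hgft : g (f t) = f t := hf2 t g hg hgt
    have h1 : Γ.Adj t (g w) := by simpa only [hgt] using g.map_adj_iff.2 htw
    have h2 : Γ.Adj (f t) (g w) := by simpa only [hgft] using g.map_adj_iff.2 hftw
    have hsub : ({f t, w, x} : Set V) ⊆ Γ.neighborSet t := by
      rintro y (rfl | rfl | rfl)
      exacts [hf1 t, htw, hx]
    have hcard : ({f t, w, x} : Set V).ncard = 3 :=
      Set.ncard_eq_three.2 ⟨_, _, _, hwt.symm, hxt.symm, Ne.symm hxw, rfl⟩
    have heq := Set.eq_of_subset_of_ncard_le hsub (by rw [hcard, hcubic])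
    have hmem : g w ∈ ({f t, w, x} : Set V) := heq ▸ h1
    rcases hmem with h | h | h
    · exact absurd h.symm h2.ne
    · exact absurd h hgw
    · rwa [← show g w = x from h]
  have hadj : ∀ v x, Γ.Adj v x → x ≠ f v → Γ.Adj (f v) x := by
    intro v x hx hxv
    obtain ⟨g, hg, rfl⟩ := htrans t v
    obtain ⟨y, rfl⟩ := g.surjective x
    rw [hequiv g hg] at hxv ⊢
    exact g.map_adj_iff.2
      (hadj_t y (g.map_adj_iff.1 hx) fun h => hxv (congrArg g h))
  have hfw_t : f w ≠ t := fun h => hwt (by rw [← h, hinv])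
  have hfw_ft : f w ≠ f t := fun h => htw.ne (hinj h).symm
  have htfw : Γ.Adj t (f w) := (hadj w t htw.symm hfw_t.symm).symm
  have hftfw : Γ.Adj (f t) (f w) := (hadj w (f t) hftw.symm hfw_ft.symm).symm
  have hwfw := hf1 w
  refine nonempty_iso_top_of_isNClique hconn (fun v => (hcubic v).le)
    (s := {t, f t, w, f w}) ?_ ?_
  · simp only [SimpleGraph.isClique_iff, Set.pairwise_insert, Set.mem_insert_iff,
      Set.mem_singleton_iff, Set.pairwise_singleton, forall_eq_or_imp, forall_eq]
    simp [hf1, (hf1 _).symm, htw, htw.symm, hftw, hftw.symm, htfw, htfw.symm, hftfw, hftfw.symm]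
  · rw [Set.ncard_insert_of_notMem, Set.ncard_eq_three.2
      ⟨_, _, _, hftw.ne, hftfw.ne, hwfw.ne, rfl⟩]
    simp [(hf1 t).ne, htw.ne, htfw.ne]
end

section
/- Let (Γ,G) be a non-degenerate locally-Z2^[3] pair. Then the action of G on the set T = {{v,v'} : v ∈ V(Γ)} (given by g·{v,v'} = {g(v), g(v')}) is faithful: if g ∈ G satisfies g({v,v'}) = {v,v'} for every vertex v, then g is the identity automorphism. -/
variable {V : Type*}

/-- Let `(Γ,G)` be a non-degenerate locally-`Z2^[3]` pair. Then the action of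
`G` on the set `T = {{v,v'} : v ∈ V(Γ)}` is faithful: if `g ∈ G` satisfies
`g({v,v'}) = {v,v'}` for every vertex `v`, then `g` is the identity automorphism. -/
theorem stmt_10 [Fintype V] (Γ : SimpleGraph V) (hconn : Γ.Connected)
    (hcubic : ∀ v : V, (Γ.neighborSet v).ncard = 3)
    (G : Subgroup (Γ ≃g Γ))
    (htrans : ∀ u w : V, ∃ g ∈ G, g u = w)
    (horb : ∀ v : V, (nbhdOrbits Γ G v).ncard = 2)
    (f : V → V)
    (hf1 : ∀ v : V, Γ.Adj v (f v))
    (hf2 : ∀ v : V, ∀ g ∈ G, g v = v → g (f v) = f v)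
    (hf3 : ∀ v u : V, Γ.Adj v u → (∀ g ∈ G, g v = v → g u = u) → u = f v)
    (hnd : ∀ u v : V, ({u, f u} : Set V) ≠ {v, f v} →
      ∀ a₁ b₁ a₂ b₂ : V, a₁ ∈ ({u, f u} : Set V) → b₁ ∈ ({v, f v} : Set V) →
        a₂ ∈ ({u, f u} : Set V) → b₂ ∈ ({v, f v} : Set V) →
        Γ.Adj a₁ b₁ → Γ.Adj a₂ b₂ → s(a₁, b₁) = s(a₂, b₂)) :
    ∀ g ∈ G, (∀ v : V, ({g v, g (f v)} : Set V) = {v, f v}) → g = 1 := by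
  intro g _ hg
  ext v
  change g v = v
  obtain ⟨u, hu, huf⟩ : ∃ u ∈ Γ.neighborSet v, u ≠ f v :=
    Set.exists_ne_of_one_lt_ncard (by rw [hcubic]; norm_num) (f v)
  have hadj : Γ.Adj v u := hu
  have hmem : ∀ w, g w ∈ ({w, f w} : Set V) := fun w => by
    rw [← hg w]
    exact Set.mem_insert _ _
  have hne : ({v, f v} : Set V) ≠ {u, f u} := by
    intro h
    have h_mem : u ∈ ({v, f v} : Set V) := by
      rw [h]
      exact Set.mem_insert _ _
    rcases h_mem with h' | h'
    · exact hadj.ne h'.symm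
    · exact huf h'
  have hedge := hnd v u hne (g v) (g u) v u (hmem v) (hmem u)
    (Set.mem_insert _ _) (Set.mem_insert _ _) (g.map_adj_iff.mpr hadj) hadj
  rcases Sym2.eq_iff.mp hedge with ⟨h, _⟩ | ⟨h, _⟩
  · exact h
  · rcases hmem v with h' | h'
    · exact h'
    · exact absurd (h.symm.trans h') huf
end

section
/- Let p be a prime, let X be a finite set, and let G be a subgroup of the group of permutations of X such that for every x ∈ X the point-stabiliser G_x = {g ∈ G : g(x) = x} is a p-group. Then for every g ∈ G, the order of g is equal to the maximum of the lengths of the orbits of the cyclic group ⟨g⟩ on X. -/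
/-- The orbit of `x` under `⟨g⟩` has length the period of `x` under `g`. -/
theorem ncard_orbit_zpowers_eq_period {α X : Type*} [Group α] [MulAction α X] [Finite X]
    (g : α) (x : X) :
    (MulAction.orbit (Subgroup.zpowers g) x).ncard = MulAction.period g x := by
  have := Fintype.ofFinite (MulAction.orbit (Subgroup.zpowers g) x)
  rw [MulAction.period_eq_minimalPeriod, MulAction.minimalPeriod_eq_card,
    ← Nat.card_coe_set_eq, Nat.card_eq_fintype_card]

/-- If the stabiliser of `x` is a `p`-group, then the order of `g` is the period of `x`
times a power of `p`. -/
theorem exists_orderOf_eq_period_mul_pow {α X : Type*} [Group α] [Finite α] [MulAction α X]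
    {p : ℕ} (hp : p.Prime) {x : X} (h : IsPGroup p (MulAction.stabilizer α x)) (g : α) :
    ∃ k : ℕ, orderOf g = MulAction.period g x * p ^ k := by
  have : Fact p.Prime := ⟨hp⟩
  have hmem : g ^ MulAction.period g x ∈ MulAction.stabilizer α x :=
    MulAction.pow_period_smul g x
  obtain ⟨k, hk⟩ := IsPGroup.iff_orderOf.mp h ⟨_, hmem⟩
  have hdvd : MulAction.period g x ∣ orderOf g := MulAction.period_dvd_orderOf g x
  have hne : MulAction.period g x ≠ 0 := fun h0 =>
    (orderOf_pos g).ne' (Nat.eq_zero_of_zero_dvd (h0 ▸ hdvd))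
  refine ⟨k, ?_⟩
  rw [Subgroup.orderOf_mk, orderOf_pow_of_dvd hne hdvd] at hk
  rw [← hk, Nat.mul_div_cancel' hdvd]

/-- If all point-stabilisers of a faithful action are `p`-groups, then every `g` has
a point whose period is the order of `g`. -/
theorem exists_period_eq_orderOf {α X : Type*} [Group α] [Finite α] [MulAction α X]
    [FaithfulSMul α X] [Nonempty X] {p : ℕ} (hp : p.Prime)
    (h : ∀ x : X, IsPGroup p (MulAction.stabilizer α x)) (g : α) :
    ∃ x : X, MulAction.period g x = orderOf g := by
  by_cases hdvd : p ∣ orderOf g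
  · obtain ⟨m, hm⟩ := hdvd
    have hpos := orderOf_pos g
    have hm0 : m ≠ 0 := by
      rintro rfl
      omega
    have hlt : m < orderOf g := by
      rw [hm]
      exact lt_mul_of_one_lt_left (Nat.pos_of_ne_zero hm0) hp.one_lt
    obtain ⟨x, hx⟩ : ∃ x : X, g ^ m • x ≠ x := by
      by_contra! hfix
      exact pow_ne_one_of_lt_orderOf hm0 hlt
        (eq_of_smul_eq_smul fun x : X => (hfix x).trans (one_smul α x).symm)
    obtain ⟨k, hk⟩ := exists_orderOf_eq_period_mul_pow hp (h x) g
    refine ⟨x, ?_⟩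
    cases k with
    | zero => simpa using hk.symm
    | succ k =>
      refine absurd (MulAction.pow_smul_eq_iff_period_dvd.mpr ⟨p ^ k, ?_⟩) hx
      apply Nat.eq_of_mul_eq_mul_left hp.pos
      rw [← hm, hk]
      ring
  · obtain ⟨x⟩ := ‹Nonempty X›
    obtain ⟨k, hk⟩ := exists_orderOf_eq_period_mul_pow hp (h x) g
    refine ⟨x, ?_⟩
    cases k with
    | zero => simpa using hk.symm
    | succ k => exact absurd (hk ▸ (dvd_pow_self p k.succ_ne_zero).mul_left _) hdvd

/-- Let `p` be a prime, `X` a finite set, and `G` a group of permutations of `X`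
in which every point-stabiliser is a `p`-group. Then for every `g ∈ G`, the order of `g` is
the maximum of the lengths of the orbits of `⟨g⟩` on `X`. -/
theorem stmt_17 {X : Type*} [Fintype X] [Nonempty X] (p : ℕ) (hp : p.Prime)
    (G : Subgroup (Equiv.Perm X))
    (hstab : ∀ x : X, IsPGroup p (MulAction.stabilizer G x)) :
    ∀ g ∈ G, IsGreatest
      {k : ℕ | ∃ x : X, k = (MulAction.orbit (Subgroup.zpowers g) x).ncard}
      (orderOf g) := by
  intro g hg
  have hperiod (x : X) : MulAction.period (⟨g, hg⟩ : G) x = MulAction.period g x := rfl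
  constructor
  · obtain ⟨x, hx⟩ := exists_period_eq_orderOf hp hstab ⟨g, hg⟩
    refine ⟨x, ?_⟩
    rw [ncard_orbit_zpowers_eq_period, ← hperiod, hx, Subgroup.orderOf_mk]
  · rintro _ ⟨x, rfl⟩
    rw [ncard_orbit_zpowers_eq_period]
    exact Nat.le_of_dvd (orderOf_pos g) (MulAction.period_dvd_orderOf g x)
end

section
/- Let Λ be a finite connected simple 4-regular graph and let G be an arc-transitive group of automorphisms of Λ such that for every vertex v, the permutation group induced by the stabiliser G_v on the neighbourhood Λ(v) is transitive and every non-identity permutation in it is fixed-point-free and of order 2 (i.e., the induced local group is permutation isomorphic to the Klein four-group Z/2 × Z/2 acting regularly). Then G_v acts faithfully on Λ(v); in particular, G_v is isomorphic to Z/2 × Z/2 and has order 4. -/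
variable {W : Type*}

/-- The stabiliser `G_v` of a vertex `v` in a group `G` of automorphisms of `Λ`, as a subgroup
of the automorphism group of `Λ`. -/
def vertexStab (Λ : SimpleGraph W) (G : Subgroup (Λ ≃g Λ)) (v : W) : Subgroup (Λ ≃g Λ) where
  carrier := {g | g ∈ G ∧ g v = v}
  one_mem' := ⟨G.one_mem, rfl⟩
  mul_mem' := @fun a b ha hb => ⟨G.mul_mem ha.1 hb.1, by
    rw [show (a * b) v = a (b v) from rfl, hb.2, ha.2]⟩
  inv_mem' := fun ha => ⟨G.inv_mem ha.1, by conv_lhs => rw [← ha.2]; simp⟩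

/-- An automorphism fixing an arc of a connected graph is trivial, provided that fixing a vertex
and one of its neighbours forces it to fix all neighbours of that vertex. -/
theorem eq_one_of_fixes_arc {Λ : SimpleGraph W} (hconn : Λ.Connected) {g : Λ ≃g Λ}
    (hg : ∀ a b c : W, Λ.Adj a b → Λ.Adj a c → g a = a → g b = b → g c = c)
    {v u : W} (huv : Λ.Adj v u) (hv : g v = v) (hu : g u = u) : g = 1 := by
  have fixes_of_walk : ∀ a b : W, Λ.Walk a b →
      g a = a → (∃ c, Λ.Adj a c ∧ g c = c) → g b = b := by
    intro a b p
    induction p with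
    | nil => exact fun h _ => h
    | cons hadj _ ih =>
      rintro ha ⟨c, hac, hc⟩
      exact ih (hg _ _ _ hac hadj ha hc) ⟨_, hadj.symm, ha⟩
  ext w
  obtain ⟨p⟩ := hconn.preconnected v w
  exact fixes_of_walk v w p hv ⟨u, huv, hu⟩

/-- Let `Λ` be a finite connected 4-regular simple graph and `G` an
arc-transitive group of automorphisms of `Λ` such that for every vertex `v` the permutation
group induced by `G_v` on `Λ(v)` is transitive and all of its non-identity elements are
fixed-point-free of order 2 (i.e. it is the Klein four-group acting regularly). Then `G_v`
acts faithfully on `Λ(v)`; in particular `G_v ≅ Z/2 × Z/2` and `|G_v| = 4`. -/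
theorem stmt_18 [Fintype W] (Λ : SimpleGraph W) (hconn : Λ.Connected)
    (hreg : ∀ w : W, (Λ.neighborSet w).ncard = 4)
    (G : Subgroup (Λ ≃g Λ))
    (harc : ∀ a b a' b' : W, Λ.Adj a b → Λ.Adj a' b' → ∃ g ∈ G, g a = a' ∧ g b = b')
    (hloctrans : ∀ v : W, ∀ u ∈ Λ.neighborSet v, ∀ w ∈ Λ.neighborSet v,
      ∃ g ∈ G, g v = v ∧ g u = w)
    (hlocklein : ∀ v : W, ∀ g ∈ G, g v = v → (∃ u ∈ Λ.neighborSet v, g u ≠ u) →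
      (∀ u ∈ Λ.neighborSet v, g u ≠ u) ∧ (∀ u ∈ Λ.neighborSet v, g (g u) = u)) :
    ∀ v : W,
      (∀ g ∈ G, g v = v → (∀ u ∈ Λ.neighborSet v, g u = u) → g = 1) ∧
      Nonempty (vertexStab Λ G v ≃* Multiplicative (ZMod 2 × ZMod 2)) ∧
      Nat.card (vertexStab Λ G v) = 4 := by
  have fixes_nbrs : ∀ g ∈ G, ∀ a b c : W, Λ.Adj a b → Λ.Adj a c → g a = a → g b = b → g c = c := by
    intro g hg a b c hab hac ha hb
    by_contra hc
    exact (hlocklein a g hg ha ⟨c, hac, hc⟩).1 b hab hb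
  intro v
  obtain ⟨u, hu⟩ : (Λ.neighborSet v).Nonempty :=
    Set.nonempty_of_ncard_ne_zero (by rw [hreg v]; norm_num)
  have eq_one : ∀ g ∈ G, g v = v → g u = u → g = 1 := fun g hg hgv hgu =>
    eq_one_of_fixes_arc hconn (fixes_nbrs g hg) hu hgv hgu
  have card_stab : Nat.card (vertexStab Λ G v) = 4 := by
    rw [← hreg v, ← Nat.card_coe_set_eq]
    refine Nat.card_eq_of_bijective
      (fun g : vertexStab Λ G v => (⟨g.1 u, ?_⟩ : Λ.neighborSet v)) ⟨?_, ?_⟩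
    · have h := (g.1.map_adj_iff (v := v) (w := u)).2 hu
      rwa [g.2.2] at h
    · intro g h hgh
      have hgh' : g.1 u = h.1 u := congrArg Subtype.val hgh
      have hmem := (h⁻¹ * g).2
      have hfix : (h⁻¹ * g).1 u = u := by
        change h.1.symm (g.1 u) = u
        rw [hgh']
        exact h.1.symm_apply_apply u
      exact (inv_mul_eq_one.1 (Subtype.ext (eq_one _ hmem.1 hmem.2 hfix))).symm
    · rintro ⟨w, hw⟩
      obtain ⟨g, hg, hgv, hgu⟩ := hloctrans v u hu w hw
      exact ⟨⟨g, hg, hgv⟩, Subtype.ext hgu⟩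
  have mul_self : ∀ g : vertexStab Λ G v, g * g = 1 := by
    intro g
    have hmem := (g * g).2
    refine Subtype.ext (eq_one _ hmem.1 hmem.2 ?_)
    change g.1 (g.1 u) = u
    by_cases h : g.1 u = u
    · rw [h, h]
    · exact (hlocklein v g.1 g.2.1 g.2.2 ⟨u, hu, h⟩).2 u hu
  refine ⟨fun g hg hgv hfix => eq_one g hg hgv (hfix u hu), ?_, card_stab⟩
  have : IsKleinFour (vertexStab Λ G v) := by
    refine ⟨card_stab, ?_⟩
    have : Nontrivial (vertexStab Λ G v) :=
      (@Finite.one_lt_card_iff_nontrivial _ (Nat.finite_of_card_ne_zero (by omega))).1 (by omega)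
    refine (Nat.prime_two.eq_one_or_self_of_dvd _
      (Monoid.exponent_dvd_of_forall_pow_eq_one fun g => by rw [pow_two, mul_self])).resolve_left ?_
    rw [Monoid.exp_eq_one_iff]
    exact not_subsingleton _
  exact IsKleinFour.nonempty_mulEquiv
end
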